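/- arXiv:2305.10781 — 4 statements merged into one kernel-verified Lean document; each statement's English description precedes it below -/
import Mathlib

section
/- Let N ≥ 0 and let w_0, …, w_N be positive real numbers with Σ_{j=0}^N w_j = 1. Let Δt, Δx > 0, let u_0, …, u_N ∈ ℝ^p, let f_{1/2}, …, f_{N-1/2} ∈ ℝ^p be interior subcell fluxes and F_-, F_+ ∈ ℝ^p be boundary fluxes. Define the subcell finite-volume update by u_0^L = u_0 − (Δt/(w_0 Δx))(f_{1/2} − F_-), u_j^L = u_j − (Δt/(w_j Δx))(f_{j+1/2} − f_{j-1/2}) for 1 ≤ j ≤ N−1, and u_N^L = u_N − (Δt/(w_N Δx))(F_+ − f_{N-1/2}). Then the weighted mean satisfies Σ_{j=0}^N w_j u_j^L = Σ_{j=0}^N w_j u_j − (Δt/Δx)(F_+ − F_-). -/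
/-- Telescoping sum over `Fin n`. -/
theorem sum_succ_sub_castSucc {M : Type*} [AddCommGroup M] {n : ℕ} (g : Fin (n + 1) → M) :
    ∑ j : Fin n, (g j.succ - g j.castSucc) = g (Fin.last n) - g 0 := by
  rw [Finset.sum_sub_distrib, sub_eq_sub_iff_add_eq_add, add_comm, ← Fin.sum_univ_succ,
    Fin.sum_univ_castSucc, add_comm]

/-- Conservation identity for the lower order finite volume scheme on subcells.
The element is divided into `N+1` subcells of widths `w j * Δx`; the face fluxes are
`g : Fin (N+2) → ℝ^p` with `g 0 = F₋` the left boundary flux, `g (last) = F₊` the right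
boundary flux, and interior values the subcell fluxes `f_{j+1/2}`.  The subcell update is
`uL j = u j - (Δt/(w j Δx)) (g (j+1) - g j)`, which encodes exactly the three stated
formulas.  Then the weighted mean telescopes. -/
theorem subcell_fv_conservation
    (N p : ℕ) (w : Fin (N + 1) → ℝ) (hw : ∀ j, 0 < w j)
    (hsum : ∑ j, w j = 1)
    (Δt Δx : ℝ) (hΔt : 0 < Δt) (hΔx : 0 < Δx)
    (u uL : Fin (N + 1) → (Fin p → ℝ))
    (g : Fin (N + 2) → (Fin p → ℝ)) (Fm Fp : Fin p → ℝ)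
    (hg0 : g 0 = Fm) (hgN : g (Fin.last (N + 1)) = Fp)
    (hup : ∀ j : Fin (N + 1),
      uL j = u j - (Δt / (w j * Δx)) • (g j.succ - g j.castSucc)) :
    ∑ j, w j • uL j = ∑ j, w j • u j - (Δt / Δx) • (Fp - Fm) := by
  have hterm (j : Fin (N + 1)) :
      w j • uL j = w j • u j - (Δt / Δx) • (g j.succ - g j.castSucc) := by
    have hj : w j * (Δt / (w j * Δx)) = Δt / Δx := by
      have := (hw j).ne'
      field_simp
    rw [hup, smul_sub, smul_smul, hj]
  simp_rw [hterm]
  rw [Finset.sum_sub_distrib, ← Finset.smul_sum, sum_succ_sub_castSucc, hg0, hgN]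
end

section
/- Let E be a real vector space, S ⊆ E a convex set, and p : E → ℝ concave on S. Let u, v ∈ S and ε ∈ ℝ with ε ≤ p(u). Define θ ∈ ℝ by θ = 1 if p(v) = p(u), and θ = min( |ε − p(u)| / |p(v) − p(u)| , 1 ) otherwise. Then θ ∈ [0,1], the point θ·v + (1−θ)·u lies in S, and p( θ·v + (1−θ)·u ) ≥ ε. -/
/-- Core scaling lemma for concave admissibility constraints: given a convex set `S`,
`p` concave on `S`, a safe state `u ∈ S` with `ε ≤ p u` and a candidate `v ∈ S`,
the scaling factor `θ` (equal to `1` if `p v = p u`, else `min (|ε - p u| / |p v - p u|) 1`)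
lies in `[0,1]`, the scaled state `θ • v + (1 - θ) • u` lies in `S`, and it satisfies
the constraint `p ≥ ε`. -/
theorem scaling_limiter_concave
    {E : Type*} [AddCommGroup E] [Module ℝ E]
    (S : Set E) (hS : Convex ℝ S) (p : E → ℝ) (hp : ConcaveOn ℝ S p)
    (u v : E) (hu : u ∈ S) (hv : v ∈ S) (ε : ℝ) (hε : ε ≤ p u)
    (θ : ℝ)
    (hθ : θ = if p v = p u then 1 else min (|ε - p u| / |p v - p u|) 1) :
    θ ∈ Set.Icc (0 : ℝ) 1 ∧ θ • v + (1 - θ) • u ∈ S ∧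
      ε ≤ p (θ • v + (1 - θ) • u) := by
  have hmem : 0 ≤ θ ∧ θ ≤ 1 ∧ θ * |p v - p u| ≤ p u - ε := by
    split_ifs at hθ with h
    · simp [hθ, h, hε]
    · have hpos : 0 < |p v - p u| := abs_pos.mpr (sub_ne_zero.mpr h)
      rw [hθ]
      refine ⟨by positivity, min_le_right _ _, ?_⟩
      calc min (|ε - p u| / |p v - p u|) 1 * |p v - p u|
          ≤ |ε - p u| / |p v - p u| * |p v - p u| := by gcongr; exact min_le_left _ _
        _ = p u - ε := by
          rw [div_mul_cancel₀ _ hpos.ne', abs_sub_comm, abs_of_nonneg (sub_nonneg.mpr hε)]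
  obtain ⟨h0, h1, hle⟩ := hmem
  have h1' : 0 ≤ 1 - θ := sub_nonneg.mpr h1
  have hsum : θ + (1 - θ) = 1 := add_sub_cancel _ _
  refine ⟨⟨h0, h1⟩, hS hv hu h0 h1' hsum, ?_⟩
  have hconc := hp.2 hv hu h0 h1' hsum
  simp only [smul_eq_mul] at hconc
  have habs := mul_le_mul_of_nonneg_left (neg_abs_le (p v - p u)) h0
  linarith
end

section
/- Fix real numbers x_{j-1/2} < x_j < x_{j+1/2}, set Δx = x_{j+1/2} − x_{j-1/2}, μ₋ = (x_{j+1/2} − x_j)/Δx and μ₊ = (x_j − x_{j-1/2})/Δx (so μ₋, μ₊ > 0 and μ₋ + μ₊ = 1). Let Δt > 0, let u^n, u⁻, u⁺, w⁻, w⁺ ∈ ℝ^p (where w⁻, w⁺ denote the half-step traces of the left and right neighbouring cells), let f̂ : ℝ^p × ℝ^p → ℝ^p be any numerical flux function, and define u* ∈ ℝ^p by μ₋ u⁻ + u* + μ₊ u⁺ = 2 u^n. Define u^{n+1,-} = u⁻ − (Δt/(μ₋ Δx/2))( f̂(u⁻, u*) − f̂(w⁻, u⁻) ), u^{n+1,*}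 = u* − (Δt/(Δx/2))( f̂(u*, u⁺) − f̂(u⁻, u*) ), u^{n+1,+} = u⁺ − (Δt/(μ₊ Δx/2))( f̂(u⁺, w⁺) − f̂(u*, u⁺) ), and u^{n+1} = u^n − (Δt/Δx)( f̂(u⁺, w⁺) − f̂(w⁻, u⁻) ). Then (μ₋/2) u^{n+1,-} + (1/2) u^{n+1,*} + (μ₊/2) u^{n+1,+} = u^{n+1}. In particular, if 𝒰 ⊆ ℝ^p is convex and u^{n+1,-}, u^{n+1,*}, u^{n+1,+} ∈ 𝒰, then u^{n+1} ∈ 𝒰. -/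
/-- Convex decomposition of the MUSCL-Hancock final update on a non-cell-centered cell:
the final update `u^{n+1}` is the convex combination (coefficients `μ₋/2, 1/2, μ₊/2`)
of three first order finite volume updates on subcells; hence admissibility of the three
subcell updates in a convex set `𝒰` implies admissibility of `u^{n+1}`. -/
theorem muscl_hancock_convex_decomposition
    (p : ℕ) (xjm xj xjp : ℝ) (hx1 : xjm < xj) (hx2 : xj < xjp)
    (Δx μm μp : ℝ)
    (hΔx : Δx = xjp - xjm)
    (hμm : μm = (xjp - xj) / Δx) (hμp : μp = (xj - xjm) / Δx)
    (Δt : ℝ) (hΔt : 0 < Δt)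
    (un um up wm wp ustar : Fin p → ℝ)
    (fhat : (Fin p → ℝ) → (Fin p → ℝ) → (Fin p → ℝ))
    (hstar : μm • um + ustar + μp • up = (2 : ℝ) • un)
    (un1m un1s un1p un1 : Fin p → ℝ)
    (hm : un1m = um - (Δt / (μm * Δx / 2)) • (fhat um ustar - fhat wm um))
    (hs : un1s = ustar - (Δt / (Δx / 2)) • (fhat ustar up - fhat um ustar))
    (hp2 : un1p = up - (Δt / (μp * Δx / 2)) • (fhat up wp - fhat ustar up))
    (hfin : un1 = un - (Δt / Δx) • (fhat up wp - fhat wm um)) :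
    (μm / 2) • un1m + (1 / 2 : ℝ) • un1s + (μp / 2) • un1p = un1 ∧
      ∀ U : Set (Fin p → ℝ), Convex ℝ U →
        un1m ∈ U → un1s ∈ U → un1p ∈ U → un1 ∈ U := by
  have hΔx_pos : 0 < Δx := by linarith
  have hμm_pos : 0 < μm := hμm ▸ div_pos (by linarith) hΔx_pos
  have hμp_pos : 0 < μp := hμp ▸ div_pos (by linarith) hΔx_pos
  have hμ_sum : μm + μp = 1 := by
    rw [hμm, hμp, ← add_div, div_eq_one_iff_eq hΔx_pos.ne']
    linarith
  have hdecomp : (μm / 2) • un1m + (1 / 2 : ℝ) • un1s + (μp / 2) • un1p = un1 := by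
    have hcm : μm / 2 * (Δt / (μm * Δx / 2)) = Δt / Δx := by field_simp
    have hcs : 1 / 2 * (Δt / (Δx / 2)) = Δt / Δx := by field_simp
    have hcp : μp / 2 * (Δt / (μp * Δx / 2)) = Δt / Δx := by field_simp
    have hun : un = (1 / 2 : ℝ) • (μm • um + ustar + μp • up) := by
      rw [hstar, smul_smul]
      norm_num
    rw [hm, hs, hp2, hfin, hun]
    simp only [smul_sub (_ / _ : ℝ) _ (_ • _), smul_smul, hcm, hcs, hcp]
    module
  refine ⟨hdecomp, fun U hU hmU hsU hpU => ?_⟩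
  have hmem := hU.sum_mem (t := Finset.univ) (w := ![μm / 2, 1 / 2, μp / 2])
    (z := ![un1m, un1s, un1p])
    (by simp [Fin.forall_fin_succ, (half_pos hμm_pos).le, (half_pos hμp_pos).le])
    (by simp only [Fin.sum_univ_three, Matrix.cons_val]; linarith)
    (by simp [Fin.forall_fin_succ, hmU, hsU, hpU])
  simp only [Fin.sum_univ_three, Matrix.cons_val] at hmem
  exact hdecomp ▸ hmem
end

section
/- Fix x_{i-1/2} < x_i < x_{i+1/2} and y_{j-1/2} < y_j < y_{j+1/2}, with μ_{−x} = (x_{i+1/2} − x_i)/(x_{i+1/2} − x_{i-1/2}), μ_{+x} = (x_i − x_{i-1/2})/(x_{i+1/2} − x_{i-1/2}), μ_{−y} = (y_{j+1/2} − y_j)/(y_{j+1/2} − y_{j-1/2}), μ_{+y} = (y_j − y_{j-1/2})/(y_{j+1/2} − y_{j-1/2}). Let u^n, δ^x, δ^y ∈ ℝ^p and define the conservative reconstructions u^{±x} = u^n + (x_{i±1/2} − x_i)·δ^x and u^{±y} = u^n + (y_{j±1/2} − y_j)·δ^y. Define u^{*,+x} by μ_{+x} u^{+x} + u^{*,+x}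 + μ_{−x} u^{−x} = 2 u^{+x}, and u^{*,+xy} by μ_{+y} u^{+y} + u^{*,+xy} + μ_{−y} u^{−y} = 2 u^{+x}. Then u^{*,+xy} = u^{*,+x} = u^n + 2(x_{i+1/2} − x_i)·δ^x. -/
/-- The weighted mean of the two face traces of a linear reconstruction is the cell value. -/
lemma weighted_face_traces_eq {E : Type*} [AddCommGroup E] [Module ℝ E] {a c b : ℝ}
    (hab : a < b) (u δ : E) :
    ((c - a) / (b - a)) • (u + (b - c) • δ) + ((b - c) / (b - a)) • (u + (a - c) • δ) = u := by
  have hne : b - a ≠ 0 := sub_ne_zero.mpr hab.ne'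
  match_scalars <;> field_simp <;> ring

/-- The auxiliary state determined by the face traces in one direction and by a target trace
`u + d • ε` is `u + (2 * d) • ε`, whatever the slope in that direction. -/
lemma auxiliary_state_eq {E : Type*} [AddCommGroup E] [Module ℝ E] {a c b : ℝ}
    (hab : a < b) (d : ℝ) (u δ ε s : E)
    (hs : ((c - a) / (b - a)) • (u + (b - c) • δ) + s + ((b - c) / (b - a)) • (u + (a - c) • δ)
      = (2 : ℝ) • (u + d • ε)) :
    s = u + (2 * d) • ε := by
  rw [add_right_comm, weighted_face_traces_eq hab] at hs
  rw [eq_sub_of_add_eq' hs]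
  module

/-- In the 2-D MUSCL-Hancock scheme with conservative reconstruction, the
cross-direction auxiliary state `u^{*,+xy}` coincides with `u^{*,+x}`, both equal to
`uⁿ + 2(x_{i+1/2} - x_i) δˣ`. -/
theorem muscl_hancock_2d_cross_state
    (p : ℕ) (xim xi xip yjm yj yjp : ℝ)
    (hx1 : xim < xi) (hx2 : xi < xip) (hy1 : yjm < yj) (hy2 : yj < yjp)
    (μmx μpx μmy μpy : ℝ)
    (hμmx : μmx = (xip - xi) / (xip - xim))
    (hμpx : μpx = (xi - xim) / (xip - xim))
    (hμmy : μmy = (yjp - yj) / (yjp - yjm))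
    (hμpy : μpy = (yj - yjm) / (yjp - yjm))
    (un δx δy upx umx upy umy ustarpx ustarpxy : Fin p → ℝ)
    (hupx : upx = un + (xip - xi) • δx) (humx : umx = un + (xim - xi) • δx)
    (hupy : upy = un + (yjp - yj) • δy) (humy : umy = un + (yjm - yj) • δy)
    (hstarx : μpx • upx + ustarpx + μmx • umx = (2 : ℝ) • upx)
    (hstarxy : μpy • upy + ustarpxy + μmy • umy = (2 : ℝ) • upx) :
    ustarpxy = ustarpx ∧ ustarpx = un + (2 * (xip - xi)) • δx := by
  subst hμmx hμpx hμmy hμpy hupx humx hupy humy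
  have hx := auxiliary_state_eq (hx1.trans hx2) _ _ _ _ _ hstarx
  have hxy := auxiliary_state_eq (hy1.trans hy2) _ _ _ _ _ hstarxy
  exact ⟨hxy.trans hx.symm, hx⟩
end
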